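/- arXiv:2509.25741 — 6 statements merged into one kernel-verified Lean document; each statement's English description precedes it below -/
import Mathlib

section
/- Let σ : ℝ → ℝ be a polynomial function that is not even, i.e., there exists z ∈ ℝ with σ(−z) ≠ σ(z). Then there exists an integer j ≥ 1 such that E_{z ~ N(0,1)}[σ(z)^j · z] ≠ 0. (Equivalently, the minimum over j ≥ 1 of the information exponent of σ^j equals 1.) -/
open MeasureTheory ProbabilityTheory

open Polynomial in
lemma integrable_eval_gaussianReal (q : ℝ[X]) :
    Integrable (fun z : ℝ => q.eval z) (gaussianReal 0 1) := by
  simp only [Polynomial.eval_eq_sum, Polynomial.sum_def]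
  refine integrable_finsetSum _ fun n _ => Integrable.const_mul ?_ _
  refine ((memLp_id_gaussianReal (μ := 0) (v := 1) (n : NNReal)).integrable_norm_pow').mono'
    (by fun_prop) ?_
  filter_upwards with z
  simp

lemma pow_le_odd_pow_sub_odd_pow {x y A : ℝ} (hA : 1 ≤ A) (hx : A ≤ |x|) (hxy : y + 1 ≤ x)
    (k : ℕ) : A ^ (2 * k) ≤ x ^ (2 * k + 1) - y ^ (2 * k + 1) := by
  have hodd : Odd (2 * k + 1) := ⟨k, rfl⟩
  have hy : y ^ (2 * k + 1) ≤ (x - 1) ^ (2 * k + 1) :=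
    hodd.strictMono_pow.monotone (by linarith)
  have hAx : A ^ (2 * k) ≤ x ^ (2 * k) := by
    rw [← Even.pow_abs ⟨k, by ring⟩ x]
    gcongr
  have key : x ^ (2 * k) ≤ x ^ (2 * k + 1) - (x - 1) ^ (2 * k + 1) := by
    rw [pow_succ, pow_succ]
    rcases le_abs.1 hx with h | h
    · have : (x - 1) ^ (2 * k) ≤ x ^ (2 * k) := by
        gcongr <;> linarith
      nlinarith
    · have : x ^ (2 * k) ≤ (x - 1) ^ (2 * k) := by
        rw [← Even.neg_pow ⟨k, by ring⟩ x, ← Even.neg_pow ⟨k, by ring⟩ (x - 1)]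
        gcongr <;> linarith
      nlinarith
  linarith

lemma integral_comp_neg_gaussianReal (f : ℝ → ℝ) :
    ∫ z, f (-z) ∂(gaussianReal 0 1) = ∫ z, f z ∂(gaussianReal 0 1) := by
  have h := (MeasurableEquiv.neg ℝ).measurableEmbedding.integral_map
    (μ := gaussianReal 0 1) (g := f)
  have hmap := gaussianReal_map_neg (μ := 0) (v := 1)
  rw [neg_zero] at hmap
  change ∫ y, f y ∂((gaussianReal 0 1).map (fun x : ℝ => -x)) = _ at h
  rw [hmap] at h
  exact h.symm

open Polynomial Filter in
lemma exists_integral_pow_mul_ne_zero_of_leadingCoeff_nonneg (p : ℝ[X])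
    (hdeg : 0 < (p - p.comp (-X)).degree) (hlc : 0 ≤ (p - p.comp (-X)).leadingCoeff) :
    ∃ j : ℕ, 1 ≤ j ∧ ∫ z : ℝ, (p.eval z) ^ j * z ∂(gaussianReal 0 1) ≠ 0 := by
  by_contra! hzero
  have hpdeg : 0 < p.degree := by
    by_contra! h
    rw [Polynomial.eq_C_of_degree_le_zero h] at hdeg
    simp at hdeg
  have hD := (p - p.comp (-X)).tendsto_atTop_of_leadingCoeff_nonneg hdeg hlc
  obtain ⟨a, ha⟩ := eventually_atTop.1 (hD.eventually_ge_atTop 1)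
  set r : ℝ := max a 1
  have hr : 1 ≤ r := le_max_right _ _
  have hdiff : ∀ z, r ≤ z → p.eval (-z) + 1 ≤ p.eval z := fun z hz => by
    have := ha z ((le_max_left _ _).trans hz)
    simp only [eval_sub, eval_comp, eval_neg, eval_X] at this
    linarith
  obtain ⟨M₀, hM₀⟩ := (isCompact_Icc (a := -r) (b := r)).exists_bound_of_continuousOn
    p.continuous.continuousOn
  set M : ℝ := max M₀ 1
  have hM : 1 ≤ M := le_max_right _ _
  have hbound : ∀ z, |z| ≤ r → |p.eval z| ≤ M := fun z hz =>
    (hM₀ z (abs_le.1 hz)).trans (le_max_left _ _)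
  obtain ⟨b, hb⟩ := eventually_atTop.1
    ((p.abs_tendsto_atTop hpdeg).eventually_ge_atTop (2 * M))
  set R : ℝ := max b r
  have hrR : r ≤ R := le_max_right _ _
  have hbR : b ≤ R := le_max_left _ _
  set γ : ℝ := (gaussianReal 0 1).real (Set.Icc R (R + 1))
  have hγ : 0 < γ := by
    refine ENNReal.toReal_pos (fun h => ?_) (measure_ne_top _ _)
    have := gaussianReal_absolutelyContinuous' 0 (v := 1) one_ne_zero h
    simp at this
  have hle : ∀ k : ℕ, 4 ^ k * γ ≤ 2 * r * M := fun k => by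
    set h : ℝ → ℝ := fun z => (p.eval z ^ (2 * k + 1) - p.eval (-z) ^ (2 * k + 1)) * z with hh
    have hpos : ∀ z, r ≤ z → 0 ≤ h z := fun z hz => by
      refine mul_nonneg (sub_nonneg.2 ?_) (by linarith)
      exact (Odd.strictMono_pow ⟨k, rfl⟩).monotone (by linarith [hdiff z hz])
    have hpoint : ∀ z, (Set.Icc R (R + 1)).indicator (fun _ => (2 * M) ^ (2 * k)) z
        ≤ h z + 2 * M ^ (2 * k + 1) * r := fun z => by
      have hc : 0 ≤ 2 * M ^ (2 * k + 1) * r := by positivity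
      by_cases hz : z ∈ Set.Icc R (R + 1)
      · rw [Set.indicator_of_mem hz]
        have h1 := pow_le_odd_pow_sub_odd_pow (by linarith) (hb z (hbR.trans hz.1))
          (hdiff z (hrR.trans hz.1)) k
        have h2 : 1 ≤ z := hr.trans (hrR.trans hz.1)
        have h3 : (0 : ℝ) ≤ (2 * M) ^ (2 * k) := by positivity
        have h4 := le_mul_of_one_le_right (h3.trans h1) h2
        linarith
      · rw [Set.indicator_of_notMem hz]
        rcases le_total r |z| with hrz | hrz
        · rcases le_abs.1 hrz with h1 | h1
          · linarith [hpos z h1]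
          · have h2 := hpos (-z) h1
            have h3 : h (-z) = h z := by simp only [hh, neg_neg]; ring
            linarith
        · have h1 : |h z| ≤ 2 * M ^ (2 * k + 1) * r := by
            rw [hh]
            dsimp only
            rw [abs_mul]
            gcongr
            refine (abs_sub _ _).trans ?_
            rw [abs_pow, abs_pow, two_mul (M ^ _)]
            exact add_le_add (pow_le_pow_left₀ (abs_nonneg _) (hbound z hrz) _)
              (pow_le_pow_left₀ (abs_nonneg _) (hbound (-z) (by rwa [abs_neg])) _)
          linarith [neg_abs_le (h z)]
    have hi1 : Integrable (fun z : ℝ => p.eval z ^ (2 * k + 1) * z) (gaussianReal 0 1) :=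
      (integrable_eval_gaussianReal (p ^ (2 * k + 1) * X)).congr (.of_forall fun z => by simp)
    have hi2 : Integrable (fun z : ℝ => p.eval (-z) ^ (2 * k + 1) * (-z)) (gaussianReal 0 1) :=
      (integrable_eval_gaussianReal (p.comp (-X) ^ (2 * k + 1) * -X)).congr
        (.of_forall fun z => by simp)
    have hsplit : h = fun z => p.eval z ^ (2 * k + 1) * z + p.eval (-z) ^ (2 * k + 1) * (-z) := by
      ext z
      simp only [hh]
      ring
    have hint : Integrable h (gaussianReal 0 1) := hsplit ▸ hi1.add hi2
    have hI : ∫ z, h z ∂(gaussianReal 0 1) = 0 := by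
      rw [hsplit, integral_add hi1 hi2,
        integral_comp_neg_gaussianReal (fun z => p.eval z ^ (2 * k + 1) * z),
        hzero _ (by omega), add_zero]
    have hmono := integral_mono (μ := gaussianReal 0 1)
      ((integrable_const _).indicator measurableSet_Icc)
      (hint.add (integrable_const (2 * M ^ (2 * k + 1) * r))) hpoint
    rw [integral_indicator_const _ measurableSet_Icc] at hmono
    simp only [Pi.add_apply] at hmono
    rw [integral_add hint (integrable_const _), hI, integral_const] at hmono
    simp only [probReal_univ, smul_eq_mul, one_mul, zero_add] at hmono
    have hMk : 0 < M ^ (2 * k) := by positivity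
    refine le_of_mul_le_mul_left ?_ hMk
    calc M ^ (2 * k) * (4 ^ k * γ) = γ * (2 * M) ^ (2 * k) := by
          rw [mul_pow, pow_mul 2 2 k]; norm_num; ring
      _ ≤ 2 * M ^ (2 * k + 1) * r := hmono
      _ = M ^ (2 * k) * (2 * r * M) := by ring
  obtain ⟨k, hk⟩ := pow_unbounded_of_one_lt (2 * r * M / γ) (by norm_num : (1 : ℝ) < 4)
  rw [div_lt_iff₀ hγ] at hk
  exact absurd (hle k) hk.not_ge

/-- If `σ = p.eval` is a polynomial function on `ℝ` that is not even,
then there exists an integer `j ≥ 1` with `E_{z ~ N(0,1)}[σ(z)^j · z] ≠ 0`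
(equivalently, `min_{j ≥ 1} ie(σ^j) = 1`). -/
theorem statement0 (p : Polynomial ℝ) (hnoteven : ∃ z : ℝ, p.eval (-z) ≠ p.eval z) :
    ∃ j : ℕ, 1 ≤ j ∧
      ∫ z : ℝ, (p.eval z) ^ j * z ∂(gaussianReal 0 1) ≠ 0 := by
  have hdeg : 0 < (p - p.comp (-Polynomial.X)).degree := by
    by_contra! h
    have hC := Polynomial.eq_C_of_degree_le_zero h
    have heval : ∀ z, p.eval z - p.eval (-z) = (p - p.comp (-Polynomial.X)).coeff 0 := fun z => by
      simpa using congrArg (Polynomial.eval z) hC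
    obtain ⟨z, hz⟩ := hnoteven
    have h0 := heval 0
    rw [neg_zero, sub_self] at h0
    exact hz (by linarith [heval z])
  rcases le_total 0 (p - p.comp (-Polynomial.X)).leadingCoeff with hlc | hlc
  · exact exists_integral_pow_mul_ne_zero_of_leadingCoeff_nonneg p hdeg hlc
  · have hneg : -p - (-p).comp (-Polynomial.X) = -(p - p.comp (-Polynomial.X)) := by
      rw [Polynomial.neg_comp]
      ring
    obtain ⟨j, hj, hne⟩ := exists_integral_pow_mul_ne_zero_of_leadingCoeff_nonneg (-p)
      (by rwa [hneg, Polynomial.degree_neg]) (by rw [hneg, Polynomial.leadingCoeff_neg]; linarith)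
    refine ⟨j, hj, fun h => hne ?_⟩
    simp only [Polynomial.eval_neg, neg_pow (p.eval _), mul_assoc]
    rw [integral_const_mul, h, mul_zero]
end

section
/- Let σ : ℝ → ℝ be a nonconstant even polynomial function. Then E_{z ~ N(0,1)}[σ(z)^j · z] = 0 for every integer j ≥ 1, and there exists an integer j ≥ 1 such that E_{z ~ N(0,1)}[σ(z)^j · (z² − 1)] ≠ 0. (Equivalently, the minimum over j ≥ 1 of the information exponent of σ^j equals 2.) -/
open MeasureTheory ProbabilityTheory

/-- Polynomials are integrable with respect to any Gaussian measure on `ℝ`. -/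
theorem integrable_polynomial_eval_gaussianReal (p : Polynomial ℝ) (m : ℝ) (v : NNReal) :
    Integrable (fun z : ℝ => p.eval z) (gaussianReal m v) := by
  induction p using Polynomial.induction_on' with
  | add p q hp hq => exact (hp.add hq).congr (ae_of_all _ fun z => by simp)
  | monomial n a =>
    simp only [Polynomial.eval_monomial]
    refine Integrable.const_mul ?_ a
    have h := (memLp_id_gaussianReal (μ := m) (v := v) (n : NNReal)).integrable_norm_pow'
    refine (integrable_norm_iff (by fun_prop)).1 ?_
    simpa using h

/-- An odd function has integral zero with respect to a centred Gaussian measure. -/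
theorem integral_gaussianReal_eq_zero_of_odd {f : ℝ → ℝ} (hf : ∀ z, f (-z) = -f z)
    (v : NNReal) : ∫ z, f z ∂(gaussianReal 0 v) = 0 := by
  have h : ∫ z, f z ∂(gaussianReal 0 v) = ∫ z, f (-z) ∂(gaussianReal 0 v) := by
    conv_lhs => rw [← neg_zero, ← gaussianReal_map_neg]
    exact integral_map_equiv (MeasurableEquiv.neg ℝ) f
  simp only [hf, integral_neg] at h
  linarith

/-- If `p` is a nonconstant polynomial, then `p ^ (2 * k)` correlates positively with the second
Hermite polynomial for some `k ≥ 1`. -/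
theorem exists_integral_even_pow_mul_sq_sub_one_pos (p : Polynomial ℝ) (hp : 0 < p.degree) :
    ∃ k : ℕ, 1 ≤ k ∧
      0 < ∫ z : ℝ, (p.eval z) ^ (2 * k) * (z ^ 2 - 1) ∂(gaussianReal 0 1) := by
  obtain ⟨C, hC⟩ := (isCompact_Icc (a := (-1 : ℝ)) (b := 1)).exists_bound_of_continuousOn
    p.continuous.continuousOn
  set B : ℝ := max C 1
  have hB : 0 < B := lt_max_of_lt_right one_pos
  have hsmall : ∀ z ∈ Set.Icc (-1 : ℝ) 1, |p.eval z| ≤ B := fun z hz =>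
    (hC z hz).trans (le_max_left _ _)
  obtain ⟨R, hR⟩ := Filter.eventually_atTop.1
    (((p.abs_tendsto_atTop hp).eventually_ge_atTop (2 * B)).and (Filter.eventually_ge_atTop 2))
  have hμ : 0 < (gaussianReal 0 1).real (Set.Ici R) := by
    refine ENNReal.toReal_pos (fun h => ?_) (measure_ne_top _ _)
    simpa using gaussianReal_absolutelyContinuous' 0 one_ne_zero h
  obtain ⟨n, hn⟩ := pow_unbounded_of_one_lt ((gaussianReal 0 1).real (Set.Ici R))⁻¹
    (by norm_num : (1 : ℝ) < 4)
  refine ⟨n + 1, by omega, ?_⟩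
  set k := n + 1
  have hk : ((gaussianReal 0 1).real (Set.Ici R))⁻¹ < 4 ^ k :=
    hn.trans_le (pow_le_pow_right₀ (by norm_num) (by omega))
  let g : ℝ → ℝ := fun z => (Set.Ici R).indicator (fun _ => (2 * B) ^ (2 * k)) z - B ^ (2 * k)
  have hind : Integrable ((Set.Ici R).indicator fun _ => (2 * B) ^ (2 * k)) (gaussianReal 0 1) :=
    (integrable_const _).indicator measurableSet_Ici
  have hg : 0 < ∫ z, g z ∂(gaussianReal 0 1) := by
    rw [integral_sub hind (integrable_const _), integral_indicator_const _ measurableSet_Ici]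
    simp only [integral_const, probReal_univ, smul_eq_mul, one_mul]
    have h1 : 1 < 4 ^ k * (gaussianReal 0 1).real (Set.Ici R) := (inv_lt_iff_one_lt_mul₀ hμ).1 hk
    have h2 : (2 * B) ^ (2 * k) = 4 ^ k * B ^ (2 * k) := by
      rw [mul_pow, pow_mul 2]; norm_num
    rw [h2]
    nlinarith [pow_pos hB (2 * k)]
  refine hg.trans_le (integral_mono (hind.sub (integrable_const _)) ?_ fun z => ?_)
  · exact (integrable_polynomial_eval_gaussianReal
      (p ^ (2 * k) * (Polynomial.X ^ 2 - 1)) 0 1).congr (ae_of_all _ fun z => by simp)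
  have hBk := pow_pos hB (2 * k)
  have hpk : 0 ≤ p.eval z ^ (2 * k) := (even_two_mul k).pow_nonneg _
  simp only [g]
  by_cases hz : z ∈ Set.Ici R
  · obtain ⟨h1, h2⟩ := hR z hz
    have h3 : (2 * B) ^ (2 * k) ≤ p.eval z ^ (2 * k) := by
      rw [← (even_two_mul k).pow_abs (p.eval z)]
      gcongr
    rw [Set.indicator_of_mem hz]
    have h4 : 0 ≤ z ^ 2 - 1 - 1 := by nlinarith
    nlinarith [mul_nonneg hpk h4]
  · rw [Set.indicator_of_notMem hz]
    by_cases hz1 : z ∈ Set.Icc (-1 : ℝ) 1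
    · have h3 : p.eval z ^ (2 * k) ≤ B ^ (2 * k) := by
        rw [← (even_two_mul k).pow_abs (p.eval z)]
        gcongr
        exact hsmall z hz1
      nlinarith [mul_nonneg hpk (sq_nonneg z)]
    · have h3 : 1 ≤ z ^ 2 := by
        rw [one_le_sq_iff_one_le_abs]
        by_contra! h
        exact hz1 (abs_le.1 h.le)
      nlinarith [mul_nonneg hpk (sub_nonneg.2 h3)]

/-- If `σ = p.eval` is a nonconstant even polynomial function on `ℝ`,
then `E_{z ~ N(0,1)}[σ(z)^j · z] = 0` for every `j ≥ 1`, and there is a `j ≥ 1` with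
`E_{z ~ N(0,1)}[σ(z)^j · (z² − 1)] ≠ 0` (equivalently, `min_{j ≥ 1} ie(σ^j) = 2`). -/
theorem statement1 (p : Polynomial ℝ)
    (heven : ∀ z : ℝ, p.eval (-z) = p.eval z)
    (hnonconst : ∃ z w : ℝ, p.eval z ≠ p.eval w) :
    (∀ j : ℕ, 1 ≤ j → ∫ z : ℝ, (p.eval z) ^ j * z ∂(gaussianReal 0 1) = 0) ∧
    ∃ j : ℕ, 1 ≤ j ∧
      ∫ z : ℝ, (p.eval z) ^ j * (z ^ 2 - 1) ∂(gaussianReal 0 1) ≠ 0 := by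
  refine ⟨fun j _ => integral_gaussianReal_eq_zero_of_odd (fun z => ?_) 1, ?_⟩
  · rw [heven, mul_neg]
  · have hp : 0 < p.degree := by
      by_contra! h
      obtain ⟨z, w, hzw⟩ := hnonconst
      rw [Polynomial.eq_C_of_degree_le_zero h] at hzw
      simp at hzw
    obtain ⟨k, hk, h⟩ := exists_integral_even_pow_mul_sq_sub_one_pos p hp
    exact ⟨2 * k, by omega, h.ne'⟩
end

section
/- Let d ≥ 1, let x be distributed according to the standard Gaussian measure N(0, I_d) on ℝ^d, let β ∈ ℝ^d be a unit vector, let w ∈ ℝ^d be arbitrary, and let i be a natural number. Then E[exp(⟨w, x⟩)·He_i(⟨β, x⟩)] = exp(‖w‖²/2)·⟨β, w⟩^i. -/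
open MeasureTheory ProbabilityTheory

/-- The standard Gaussian measure `N(0, I_d)` on `ℝ^d`, as the product of `d`
copies of the standard Gaussian on `ℝ`. -/
noncomputable def stdGaussian (d : ℕ) : Measure (Fin d → ℝ) :=
  Measure.pi fun _ => gaussianReal 0 1

/-- The `k`-th probabilists' Hermite polynomial, evaluated at `z : ℝ`. -/
noncomputable def He (k : ℕ) (z : ℝ) : ℝ :=
  Polynomial.aeval z (Polynomial.hermite k)

/-- The moment generating function of `N(0, I_d)`. -/
lemma integral_exp_sum_mul_stdGaussian (d : ℕ) (v : Fin d → ℝ) :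
    ∫ x : Fin d → ℝ, Real.exp (∑ k, v k * x k) ∂(stdGaussian d)
      = Real.exp ((∑ k, (v k) ^ 2) / 2) := by
  have h1 (a : ℝ) : ∫ y, Real.exp (a * y) ∂(gaussianReal 0 1) = Real.exp (a ^ 2 / 2) := by
    have := congrFun (mgf_fun_id_gaussianReal (μ := 0) (v := 1)) a
    simpa [mgf] using this
  simp_rw [Real.exp_sum, _root_.stdGaussian]
  rw [integral_fintype_prod_eq_prod (fun k y => Real.exp (v k * y))]
  simp_rw [h1, ← Real.exp_sum, Finset.sum_div]

/-- Three-term recurrence for the iterated derivatives of the moment generating function of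
`N(r, 1)`. -/
lemma iteratedDeriv_succ_exp_quadratic (r : ℝ) (n : ℕ) (t : ℝ) :
    iteratedDeriv (n + 1) (fun t : ℝ => Real.exp (r * t + t ^ 2 / 2)) t
      = (r + t) * iteratedDeriv n (fun t : ℝ => Real.exp (r * t + t ^ 2 / 2)) t
        + n * iteratedDeriv (n - 1) (fun t : ℝ => Real.exp (r * t + t ^ 2 / 2)) t := by
  set g := fun t : ℝ => Real.exp (r * t + t ^ 2 / 2) with hg
  have hsmooth : ContDiff ℝ ⊤ g := by fun_prop
  have hd (m : ℕ) (s : ℝ) : HasDerivAt (iteratedDeriv m g) (iteratedDeriv (m + 1) g s) s := by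
    rw [iteratedDeriv_succ]
    exact ((hsmooth.differentiable_iteratedDeriv m (WithTop.coe_lt_top _)) s).hasDerivAt
  induction n generalizing t with
  | zero =>
    have hlin : HasDerivAt (fun t : ℝ => r * t + t ^ 2 / 2) (r + t) t := by
      refine (((hasDerivAt_id t).const_mul r).add
        (((hasDerivAt_id t).pow 2).div_const 2)).congr_deriv ?_
      simp
    simp [hg, iteratedDeriv_one, hlin.exp.deriv, mul_comm]
  | succ n ih =>
    have hrhs : HasDerivAt
        (fun t => (r + t) * iteratedDeriv n g t + n * iteratedDeriv (n - 1) g t)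
        (1 * iteratedDeriv n g t + (r + t) * iteratedDeriv (n + 1) g t
          + n * iteratedDeriv (n - 1 + 1) g t) t :=
      (((hasDerivAt_id t).const_add r).mul (hd n t)).add ((hd (n - 1) t).const_mul _)
    rw [← funext ih] at hrhs
    rw [(hd (n + 1) t).unique hrhs]
    rcases n with _ | n
    · simp
      ring
    · simp
      ring

/-- A random variable with the moment generating function of `N(r, 1)` satisfies
`E[He_i(Z)] = r ^ i`. -/
lemma integral_He_of_mgf_eq {Ω : Type*} [MeasurableSpace Ω] {ν : Measure Ω} [NeZero ν]
    {Z : Ω → ℝ} {r : ℝ} (hZ : mgf Z ν = fun t => Real.exp (r * t + t ^ 2 / 2)) (i : ℕ) :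
    ∫ ω, He i (Z ω) ∂ν = r ^ i := by
  have huniv : integrableExpSet Z ν = Set.univ := by
    ext t
    simp only [integrableExpSet, Set.mem_ofPred_eq, Set.mem_univ, iff_true]
    rw [← mgf_pos_iff, hZ]
    exact Real.exp_pos _
  have h0 : (0 : ℝ) ∈ interior (integrableExpSet Z ν) := by simp [huniv]
  have hpow (n : ℕ) : Integrable (fun ω => Z ω ^ n) ν :=
    integrable_pow_of_mem_interior_integrableExpSet h0 n
  have hmom (n : ℕ) : ∫ ω, Z ω ^ (n + 1) ∂ν
      = r * ∫ ω, Z ω ^ n ∂ν + n * ∫ ω, Z ω ^ (n - 1) ∂ν := by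
    have hm (k : ℕ) := iteratedDeriv_mgf_zero h0 k
    have := iteratedDeriv_succ_exp_quadratic r n 0
    rw [← hZ, hm, hm, hm] at this
    simpa using this
  have hint (p : Polynomial ℝ) : Integrable (fun ω => p.eval (Z ω)) ν := by
    simp_rw [Polynomial.eval_eq_sum_range]
    exact integrable_finsetSum _ fun n _ => (hpow n).const_mul _
  have hstein (p : Polynomial ℝ) :
      ∫ ω, (Polynomial.X * p - Polynomial.derivative p).eval (Z ω) ∂ν
        = r * ∫ ω, p.eval (Z ω) ∂ν := by
    induction p using Polynomial.induction_on' with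
    | add p q hp hq =>
      have e (ω : Ω) : (Polynomial.X * (p + q) - Polynomial.derivative (p + q)).eval (Z ω)
          = (Polynomial.X * p - Polynomial.derivative p).eval (Z ω)
            + (Polynomial.X * q - Polynomial.derivative q).eval (Z ω) := by
        simp only [Polynomial.derivative_add, Polynomial.eval_sub, Polynomial.eval_mul,
          Polynomial.eval_add]
        ring
      simp_rw [e, Polynomial.eval_add]
      rw [integral_add (hint _) (hint _), integral_add (hint _) (hint _), hp, hq, mul_add]
    | monomial n a =>
      have e (ω : Ω) : (Polynomial.X * Polynomial.monomial n a
          - Polynomial.derivative (Polynomial.monomial n a)).eval (Z ω)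
          = a * Z ω ^ (n + 1) - a * n * Z ω ^ (n - 1) := by
        simp [Polynomial.derivative_monomial]
      simp_rw [e, Polynomial.eval_monomial]
      rw [integral_sub ((hpow _).const_mul _) ((hpow _).const_mul _), integral_const_mul,
        integral_const_mul, integral_const_mul, hmom]
      ring
  have hHe (k : ℕ) (z : ℝ) :
      He k z = ((Polynomial.hermite k).map (algebraMap ℤ ℝ)).eval z := by
    rw [He, Polynomial.eval_map_algebraMap]
  simp_rw [hHe]
  induction i with
  | zero =>
    have := congrFun hZ 0
    simpa [mgf] using this
  | succ k ih =>
    rw [Polynomial.hermite_succ, Polynomial.map_sub, Polynomial.map_mul, Polynomial.map_X,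
      ← Polynomial.derivative_map, hstein, ih, pow_succ']

/-- For `x ~ N(0, I_d)`, a unit vector `β ∈ ℝ^d`, any `w ∈ ℝ^d` and `i : ℕ`,
`E[exp(⟨w,x⟩)·He_i(⟨β,x⟩)] = exp(‖w‖²/2)·⟨β,w⟩^i`. -/
theorem statement3 (d : ℕ) (hd : 1 ≤ d) (β w : Fin d → ℝ)
    (hβ : ∑ k, (β k) ^ 2 = 1) (i : ℕ) :
    ∫ x : Fin d → ℝ, Real.exp (∑ k, w k * x k) * He i (∑ k, β k * x k) ∂(stdGaussian d)
      = Real.exp ((∑ k, (w k) ^ 2) / 2) * (∑ k, β k * w k) ^ i := by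
  have hw := integral_exp_sum_mul_stdGaussian d w
  have hwi : Integrable (fun x : Fin d → ℝ => Real.exp (∑ k, w k * x k)) (stdGaussian d) :=
    Integrable.of_integral_ne_zero (hw ▸ (Real.exp_pos _).ne')
  have : IsProbabilityMeasure (stdGaussian d) := by
    unfold _root_.stdGaussian
    infer_instance
  have : IsProbabilityMeasure ((stdGaussian d).tilted fun x => ∑ k, w k * x k) :=
    isProbabilityMeasure_tilted hwi
  have hmgf : mgf (fun x : Fin d → ℝ => ∑ k, β k * x k)
      ((stdGaussian d).tilted fun x => ∑ k, w k * x k)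
      = fun t => Real.exp ((∑ k, β k * w k) * t + t ^ 2 / 2) := by
    ext t
    have e (x : Fin d → ℝ) : Real.exp (∑ k, w k * x k) * Real.exp (t * ∑ k, β k * x k)
        = Real.exp (∑ k, (w k + t * β k) * x k) := by
      rw [← Real.exp_add, Finset.mul_sum, ← Finset.sum_add_distrib]
      congr 1
      exact Finset.sum_congr rfl fun k _ => by ring
    have hsq : ∑ k, (w k + t * β k) ^ 2
        = ∑ k, (w k) ^ 2 + 2 * t * ∑ k, β k * w k + t ^ 2 := by
      rw [← mul_one (t ^ 2), ← hβ, Finset.mul_sum, Finset.mul_sum, ← Finset.sum_add_distrib,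
        ← Finset.sum_add_distrib]
      exact Finset.sum_congr rfl fun k _ => by ring
    rw [mgf, integral_tilted, hw]
    simp_rw [smul_eq_mul, div_mul_eq_mul_div, e]
    rw [integral_div, integral_exp_sum_mul_stdGaussian, hsq, ← Real.exp_sub]
    congr 1
    ring
  have key := integral_He_of_mgf_eq hmgf i
  rw [integral_tilted, hw] at key
  simp_rw [smul_eq_mul, div_mul_eq_mul_div] at key
  rw [integral_div, div_eq_iff (Real.exp_pos _).ne'] at key
  rw [key, mul_comm]
end

section
/- Assume the random-feature representation hypothesis, and additionally that |π'_k(v, b)| ≤ M for all k ∈ {0,…,P}, v ∈ {−1,+1}, b ∈ [−1,1]. Let σ*(z) = Σ_{k=0}^P s_k·z^k be a real polynomial, let L > 0, define π(v, b) = Σ_{k=0}^P s_k·L^{k−1}·π'_k(v, b/L), and set S := M·Σ_{k=0}^P |s_k|·L^{k−1}. Then |π(v, b)| ≤ S for all v, b, and for every δ ≥ 0 and every z, g ∈ ℝ with |z| ≤ L and |g − z| ≤ δ, |E_{v ~ Unif{±1}, b ~ Unif[−L,L]}[π(v, b)·ReLU(v·g + b)] − σ*(z)| ≤ S·δ. 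-/
open MeasureTheory

/-- The uniform distribution on `{−1, +1} ⊆ ℝ`. -/
noncomputable def coin : Measure ℝ :=
  (2⁻¹ : ENNReal) • Measure.dirac (-1) + (2⁻¹ : ENNReal) • Measure.dirac 1

/-- The uniform (normalized Lebesgue) distribution on `[−L, L] ⊆ ℝ`. -/
noncomputable def unifSeg (L : ℝ) : Measure ℝ :=
  (ENNReal.ofReal (2 * L))⁻¹ • volume.restrict (Set.Icc (-L) L)

instance isProbabilityMeasure_coin : IsProbabilityMeasure coin := by
  constructor
  simp [coin, ENNReal.inv_two_add_inv_two]

theorem isProbabilityMeasure_unifSeg {L : ℝ} (hL : 0 < L) :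
    IsProbabilityMeasure (unifSeg L) := by
  constructor
  have h : L - -L = 2 * L := by ring
  simp only [unifSeg, Measure.smul_apply, Measure.restrict_apply_univ, Real.volume_Icc, h,
    smul_eq_mul]
  exact ENNReal.inv_mul_cancel (by simpa using hL) ENNReal.ofReal_ne_top

theorem unifSeg_eq_map {L : ℝ} (hL : 0 < L) :
    unifSeg L = (unifSeg 1).map (fun b => L * b) := by
  have hpre : (fun b : ℝ => L * b) ⁻¹' Set.Icc (-L) L = Set.Icc (-1) 1 := by
    ext b
    simp only [Set.mem_preimage, Set.mem_Icc]
    constructor <;> rintro ⟨h1, h2⟩ <;> constructor <;> nlinarith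
  have hvol : Measure.map (fun b : ℝ => L * b) volume = ENNReal.ofReal |L⁻¹| • volume :=
    Real.map_volume_mul_left hL.ne'
  have hc : (ENNReal.ofReal (2 * L))⁻¹ =
      (ENNReal.ofReal (2 * 1))⁻¹ * ENNReal.ofReal |L⁻¹| := by
    rw [abs_of_pos (inv_pos.2 hL), ← ENNReal.ofReal_inv_of_pos (by positivity),
      ← ENNReal.ofReal_inv_of_pos (by positivity), ← ENNReal.ofReal_mul (by positivity)]
    congr 1
    field_simp
  rw [unifSeg, unifSeg, Measure.map_smul, ← hpre,
    ← Measure.restrict_map (measurable_const_mul L) measurableSet_Icc, hvol,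
    Measure.restrict_smul, smul_smul, hc]

theorem integral_coin_prod_unifSeg {L : ℝ} (hL : 0 < L) (f : ℝ × ℝ → ℝ) :
    ∫ p, f p ∂(coin.prod (unifSeg L)) =
      ∫ p, f (p.1, L * p.2) ∂(coin.prod (unifSeg 1)) := by
  have := isProbabilityMeasure_unifSeg one_pos
  have hmap : coin.prod (unifSeg L) =
      (coin.prod (unifSeg 1)).map (Prod.map id (fun b => L * b)) := by
    rw [← Measure.map_prod_map _ _ measurable_id (measurable_const_mul L), Measure.map_id,
      ← unifSeg_eq_map hL]
  have hemb : MeasurableEmbedding (Prod.map (id : ℝ → ℝ) (fun b : ℝ => L * b)) :=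
    MeasurableEmbedding.id.prodMap (measurableEmbedding_mulLeft₀ hL.ne')
  rw [hmap, hemb.integral_map]
  rfl

theorem ae_coin_mem : ∀ᵐ v ∂coin, v ∈ ({-1, 1} : Set ℝ) := by
  rw [ae_iff]
  simp [coin]

theorem ae_coin_prod_unifSeg_mem : ∀ᵐ p ∂(coin.prod (unifSeg 1)),
    p.1 ∈ ({-1, 1} : Set ℝ) ∧ p.2 ∈ Set.Icc (-1 : ℝ) 1 := by
  have := isProbabilityMeasure_unifSeg one_pos
  have hb : ∀ᵐ b ∂(unifSeg 1), b ∈ Set.Icc (-1 : ℝ) 1 :=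
    Measure.ae_smul_measure (ae_restrict_mem measurableSet_Icc) _
  exact (Measure.quasiMeasurePreserving_fst.ae ae_coin_mem).and
    (Measure.quasiMeasurePreserving_snd.ae hb)

theorem abs_sum_mul_le {P : ℕ} {M L : ℝ} (hL : 0 < L) (s a : ℕ → ℝ)
    (ha : ∀ k ≤ P, |a k| ≤ M) :
    |∑ k ∈ Finset.range (P + 1), s k * L ^ ((k : ℤ) - 1) * a k|
      ≤ M * ∑ k ∈ Finset.range (P + 1), |s k| * L ^ ((k : ℤ) - 1) := by
  rw [Finset.mul_sum]
  refine (Finset.abs_sum_le_sum_abs _ _).trans (Finset.sum_le_sum fun k hk => ?_)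
  have hp : 0 < L ^ ((k : ℤ) - 1) := zpow_pos hL _
  rw [abs_mul, abs_mul, abs_of_pos hp, mul_comm M]
  exact mul_le_mul_of_nonneg_left (ha k (Nat.lt_succ_iff.1 (Finset.mem_range.1 hk)))
    (by positivity)

theorem abs_relu_sub_relu_le {v z g c δ : ℝ} (hv : v ∈ ({-1, 1} : Set ℝ)) (h : |g - z| ≤ δ) :
    |max (v * g + c) 0 - max (v * z + c) 0| ≤ δ := by
  refine (abs_max_sub_max_le_abs _ _ _).trans ?_
  have hva : |v| = 1 := by
    rcases hv with rfl | rfl <;> simp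
  rwa [add_sub_add_right_eq_sub, ← mul_sub, abs_mul, hva, one_mul]

theorem integrable_mul_relu {q : ℝ → ℝ → ℝ} {M : ℝ}
    (hmeas : Measurable fun p : ℝ × ℝ => q p.1 p.2)
    (hM : ∀ v ∈ ({-1, 1} : Set ℝ), ∀ b ∈ Set.Icc (-1 : ℝ) 1, |q v b| ≤ M) (L x : ℝ) :
    Integrable (fun p : ℝ × ℝ => q p.1 p.2 * max (p.1 * x + L * p.2) 0)
      (coin.prod (unifSeg 1)) := by
  have := isProbabilityMeasure_unifSeg one_pos
  refine Integrable.of_bound (C := M * (|x| + |L|))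
    (hmeas.mul (by fun_prop)).aestronglyMeasurable ?_
  filter_upwards [ae_coin_prod_unifSeg_mem] with p hp
  have hq := hM _ hp.1 _ hp.2
  have hva : |p.1| = 1 := by
    rcases hp.1 with h | h <;> rw [h] <;> simp
  have hr : |max (p.1 * x + L * p.2) 0| ≤ |x| + |L| := by
    calc |max (p.1 * x + L * p.2) 0| ≤ |p.1 * x + L * p.2| := by
          simpa using abs_max_sub_max_le_abs (p.1 * x + L * p.2) 0 0
      _ ≤ |p.1 * x| + |L * p.2| := abs_add_le _ _
      _ ≤ |x| + |L| := by
          rw [abs_mul, abs_mul, hva, one_mul]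
          gcongr
          exact mul_le_of_le_one_right (abs_nonneg _) (abs_le.2 hp.2)
  rw [Real.norm_eq_abs, abs_mul]
  exact mul_le_mul hq hr (abs_nonneg _) ((abs_nonneg _).trans hq)

theorem integral_mul_relu_scaled {q : ℝ → ℝ → ℝ} {k : ℕ} {L z : ℝ} (hL : 0 < L) (hz : |z| ≤ L)
    (hrep : ∀ z : ℝ, |z| ≤ 1 →
      ∫ p : ℝ × ℝ, q p.1 p.2 * max (p.1 * z + p.2) 0 ∂(coin.prod (unifSeg 1)) = z ^ k) :
    ∫ p : ℝ × ℝ, q p.1 p.2 * max (p.1 * z + L * p.2) 0 ∂(coin.prod (unifSeg 1))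
      = L * (z / L) ^ k := by
  rw [← hrep (z / L) (by rwa [abs_div, abs_of_pos hL, div_le_one hL]), ← integral_const_mul]
  congr 1 with p
  have h : p.1 * z + L * p.2 = L * (p.1 * (z / L) + p.2) := by field_simp
  have hmax : max (L * (p.1 * (z / L) + p.2)) 0 = L * max (p.1 * (z / L) + p.2) 0 := by
    rw [mul_max_of_nonneg _ _ hL.le, mul_zero]
  rw [h, hmax]
  ring

/-- Under the random-feature representation hypothesis with the uniform
bound `|π'_k(v,b)| ≤ M`, setting `π(v,b) = Σ_{k=0}^P s_k·L^{k−1}·π'_k(v, b/L)` and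
`S = M·Σ_{k=0}^P |s_k|·L^{k−1}`: `|π(v,b)| ≤ S` for all `v ∈ {±1}, b ∈ [−L,L]`, and for
every `δ ≥ 0` and `z, g` with `|z| ≤ L`, `|g − z| ≤ δ`,
`|E_{v ~ Unif{±1}, b ~ Unif[−L,L]}[π(v,b)·ReLU(v·g+b)] − σ*(z)| ≤ S·δ`. -/
theorem statement12 (P : ℕ) (q' : ℕ → ℝ → ℝ → ℝ) (M : ℝ)
    (hmeas : ∀ k, Measurable fun p : ℝ × ℝ => q' k p.1 p.2)
    (hM : ∀ k ≤ P, ∀ v ∈ ({-1, 1} : Set ℝ), ∀ b ∈ Set.Icc (-1 : ℝ) 1, |q' k v b| ≤ M)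
    (hrep : ∀ k ≤ P, ∀ z : ℝ, |z| ≤ 1 →
      ∫ p : ℝ × ℝ, q' k p.1 p.2 * max (p.1 * z + p.2) 0 ∂(coin.prod (unifSeg 1)) = z ^ k)
    (s : ℕ → ℝ) (L : ℝ) (hL : 0 < L) :
    (∀ v ∈ ({-1, 1} : Set ℝ), ∀ b ∈ Set.Icc (-L) L,
      |∑ k ∈ Finset.range (P + 1), s k * L ^ ((k : ℤ) - 1) * q' k v (b / L)|
        ≤ M * ∑ k ∈ Finset.range (P + 1), |s k| * L ^ ((k : ℤ) - 1)) ∧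
    ∀ δ : ℝ, 0 ≤ δ → ∀ z g : ℝ, |z| ≤ L → |g - z| ≤ δ →
      |(∫ p : ℝ × ℝ,
          (∑ k ∈ Finset.range (P + 1), s k * L ^ ((k : ℤ) - 1) * q' k p.1 (p.2 / L))
            * max (p.1 * g + p.2) 0 ∂(coin.prod (unifSeg L)))
          - ∑ k ∈ Finset.range (P + 1), s k * z ^ k|
        ≤ (M * ∑ k ∈ Finset.range (P + 1), |s k| * L ^ ((k : ℤ) - 1)) * δ := by
  refine ⟨fun v hv b hb => abs_sum_mul_le hL s _ fun k hk => hM k hk v hv _ ⟨?_, ?_⟩, ?_⟩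
  · rw [le_div_iff₀ hL]
    linarith [hb.1]
  · rw [div_le_one hL]
    exact hb.2
  intro δ _ z g hz hg
  have := isProbabilityMeasure_unifSeg one_pos
  have hint : ∀ x : ℝ, ∀ k ∈ Finset.range (P + 1), Integrable (fun p : ℝ × ℝ =>
      s k * L ^ ((k : ℤ) - 1) * (q' k p.1 p.2 * max (p.1 * x + L * p.2) 0))
      (coin.prod (unifSeg 1)) := fun x k hk =>
    (integrable_mul_relu (hmeas k) (hM k (Nat.lt_succ_iff.1 (Finset.mem_range.1 hk))) L
      x).const_mul _
  have hpoly : ∑ k ∈ Finset.range (P + 1), s k * z ^ k =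
      ∫ p : ℝ × ℝ, ∑ k ∈ Finset.range (P + 1),
        s k * L ^ ((k : ℤ) - 1) * (q' k p.1 p.2 * max (p.1 * z + L * p.2) 0)
        ∂(coin.prod (unifSeg 1)) := by
    rw [integral_finsetSum _ (hint z)]
    refine Finset.sum_congr rfl fun k hk => ?_
    rw [integral_const_mul, integral_mul_relu_scaled hL hz
      (hrep k (Nat.lt_succ_iff.1 (Finset.mem_range.1 hk))), zpow_sub_one₀ hL.ne', zpow_natCast,
      div_pow]
    field_simp
  rw [integral_coin_prod_unifSeg hL, hpoly]
  simp only [mul_div_cancel_left₀ _ hL.ne', Finset.sum_mul, mul_assoc (_ * _)]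
  rw [← integral_sub (integrable_finsetSum _ (hint g)) (integrable_finsetSum _ (hint z)),
    ← Real.norm_eq_abs]
  refine (norm_integral_le_of_norm_le_const (C := (M * ∑ k ∈ Finset.range (P + 1),
    |s k| * L ^ ((k : ℤ) - 1)) * δ) ?_).trans_eq (by simp)
  filter_upwards [ae_coin_prod_unifSeg_mem] with p hp
  have hS := abs_sum_mul_le hL s (fun k => q' k p.1 p.2)
    fun k hk => hM k hk _ hp.1 _ hp.2
  simp only [← mul_assoc, ← Finset.sum_mul, ← mul_sub, Real.norm_eq_abs, abs_mul (Finset.sum _ _)]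
  exact mul_le_mul hS (abs_relu_sub_relu_le hp.1 hg) (abs_nonneg _) ((abs_nonneg _).trans hS)
end

section
/- Let c > 0 and let k ≥ 1 be an integer, define F(x) = x + c·x^k·(1 − x²) and C_k := ((k+1)/(k+2))^{(k−1)/2}. Then for every a with √((k+1)/(k+2)) ≤ a < 1, one has 1 − F(a) ≤ (1 − c·C_k)·(1 − a). -/
/-- For `c > 0`, integer `k ≥ 1`, `F(x) = x + c·x^k·(1 − x²)` and
`C_k = ((k+1)/(k+2))^{(k−1)/2}`, every `a` with `√((k+1)/(k+2)) ≤ a < 1` satisfies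
`1 − F(a) ≤ (1 − c·C_k)·(1 − a)`. -/
theorem statement16 (c : ℝ) (hc : 0 < c) (k : ℕ) (hk : 1 ≤ k) :
    ∀ a : ℝ, Real.sqrt (((k : ℝ) + 1) / ((k : ℝ) + 2)) ≤ a → a < 1 →
      1 - (a + c * a ^ k * (1 - a ^ 2))
        ≤ (1 - c * (((k : ℝ) + 1) / ((k : ℝ) + 2)) ^ (((k : ℝ) - 1) / 2)) * (1 - a) := by
  intro a ha ha1
  set r : ℝ := ((k : ℝ) + 1) / ((k : ℝ) + 2) with hr
  have hr0 : 0 ≤ r := by positivity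
  have hr_half : 1 / 2 ≤ r := by
    rw [hr, div_le_div_iff₀ (by norm_num) (by positivity)]
    have := k.cast_nonneg (α := ℝ)
    linarith
  have ha0 : 0 ≤ a := (Real.sqrt_nonneg r).trans ha
  have hra : r ≤ a ^ 2 := (Real.sqrt_le_left ha0).1 ha
  obtain ⟨n, rfl⟩ : ∃ n, k = n + 1 := ⟨k - 1, by omega⟩
  have hC : r ^ ((((n + 1 : ℕ) : ℝ) - 1) / 2) = Real.sqrt r ^ n := by
    rw [Real.sqrt_eq_rpow, ← Real.rpow_natCast, ← Real.rpow_mul hr0]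
    congr 1
    push_cast
    ring
  rw [hC]
  have hpow : Real.sqrt r ^ n ≤ a ^ n := pow_le_pow_left₀ (Real.sqrt_nonneg r) ha n
  have hquad : 1 ≤ a * (1 + a) := by nlinarith
  have hkey : Real.sqrt r ^ n ≤ a ^ (n + 1) * (1 + a) :=
    calc Real.sqrt r ^ n ≤ a ^ n := hpow
      _ ≤ a ^ n * (a * (1 + a)) := le_mul_of_one_le_right (pow_nonneg ha0 n) hquad
      _ = a ^ (n + 1) * (1 + a) := by ring
  calc 1 - (a + c * a ^ (n + 1) * (1 - a ^ 2))
      = (1 - c * (a ^ (n + 1) * (1 + a))) * (1 - a) := by ring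
    _ ≤ (1 - c * Real.sqrt r ^ n) * (1 - a) := by
      gcongr
end

section
/- Let k ≥ 1 be an integer and let 0 < c ≤ 1/2; define F(x) = x + c·x^k·(1 − x²) and C_k := ((k+1)/(k+2))^{(k−1)/2}. Let (a_n)_{n ≥ 0} be defined by a_{n+1} = F(a_n) with √((k+1)/(k+2)) ≤ a_0 ≤ 1. Then for every n ≥ 0: a_0 ≤ a_n ≤ 1 and 1 − a_n ≤ (1 − c·C_k)^n·(1 − a_0); in particular the alignment 1 − a_n converges to 0 geometrically. -/
/-- A half-integer power is an integer power of the square root. -/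
theorem rpow_natCast_div_two_eq_sqrt_pow {r : ℝ} (hr : 0 ≤ r) (m : ℕ) :
    r ^ ((m : ℝ) / 2) = Real.sqrt r ^ m := by
  rw [Real.sqrt_eq_rpow, ← Real.rpow_natCast, ← Real.rpow_mul hr]
  congr 1
  ring

/-- If `2/3 ≤ s²` and `s ≤ x ≤ 1`, then `s ^ m` is a lower bound for the contraction factor
`x ^ (m + 1) * (1 + x)`. -/
theorem pow_le_pow_succ_mul_one_add {s x : ℝ} (m : ℕ) (hs : 0 ≤ s) (hs2 : 2 / 3 ≤ s ^ 2)
    (hsx : s ≤ x) (hx : x ≤ 1) : s ^ m ≤ x ^ (m + 1) * (1 + x) := by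
  have hx0 : 0 ≤ x := hs.trans hsx
  calc s ^ m ≤ x ^ m := pow_le_pow_left₀ hs hsx m
    _ ≤ x ^ m * (x * (1 + x)) := le_mul_of_one_le_right (by positivity) (by nlinarith)
    _ = x ^ (m + 1) * (1 + x) := by ring

/-- For an integer `k ≥ 1`, `0 < c ≤ 1/2`, `F(x) = x + c·x^k·(1 − x²)`,
`C_k = ((k+1)/(k+2))^{(k−1)/2}`, and the sequence `a_{n+1} = F(a_n)` started at
`√((k+1)/(k+2)) ≤ a_0 ≤ 1`: for every `n`, `a_0 ≤ a_n ≤ 1` and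
`1 − a_n ≤ (1 − c·C_k)^n·(1 − a_0)`, i.e. the alignment converges geometrically. -/
theorem statement17 (k : ℕ) (hk : 1 ≤ k) (c : ℝ) (hc : 0 < c) (hc2 : c ≤ 1 / 2)
    (a : ℕ → ℝ)
    (ha0l : Real.sqrt (((k : ℝ) + 1) / ((k : ℝ) + 2)) ≤ a 0) (ha0u : a 0 ≤ 1)
    (hrec : ∀ n, a (n + 1) = a n + c * (a n) ^ k * (1 - (a n) ^ 2)) :
    ∀ n : ℕ, (a 0 ≤ a n ∧ a n ≤ 1) ∧
      1 - a n
        ≤ (1 - c * (((k : ℝ) + 1) / ((k : ℝ) + 2)) ^ (((k : ℝ) - 1) / 2)) ^ n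
            * (1 - a 0) := by
  obtain ⟨m, rfl⟩ : ∃ m, k = m + 1 := ⟨k - 1, by omega⟩
  set r : ℝ := (((m + 1 : ℕ) : ℝ) + 1) / (((m + 1 : ℕ) : ℝ) + 2) with hr
  have hr0 : 0 ≤ r := by positivity
  have hr23 : 2 / 3 ≤ r := by
    rw [hr, div_le_div_iff₀ (by norm_num) (by positivity)]
    push_cast
    linarith [(Nat.cast_nonneg m : (0 : ℝ) ≤ m)]
  have hC : r ^ ((((m + 1 : ℕ) : ℝ) - 1) / 2) = Real.sqrt r ^ m := by
    rw [← rpow_natCast_div_two_eq_sqrt_pow hr0]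
    push_cast
    congr 1
    ring
  rw [hC]
  have hs0 := Real.sqrt_nonneg r
  have hs2 : 2 / 3 ≤ Real.sqrt r ^ 2 := by rwa [Real.sq_sqrt hr0]
  intro n
  induction n with
  | zero => simpa using ha0u
  | succ n ih =>
    obtain ⟨⟨hl, hu⟩, hgeom⟩ := ih
    have hsx := ha0l.trans hl
    have hx0 : 0 ≤ a n := hs0.trans hsx
    have hgap : 0 ≤ 1 - a n := sub_nonneg.mpr hu
    have hlow := pow_le_pow_succ_mul_one_add m hs0 hs2 hsx hu
    have hup : a n ^ (m + 1) * (1 + a n) ≤ 2 := by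
      nlinarith [pow_le_one₀ hx0 hu (n := m + 1)]
    have hfactor : 1 - a (n + 1) = (1 - c * (a n ^ (m + 1) * (1 + a n))) * (1 - a n) := by
      rw [hrec]
      ring
    have hnonneg : 0 ≤ 1 - c * (a n ^ (m + 1) * (1 + a n)) := by nlinarith
    have hle : 1 - c * (a n ^ (m + 1) * (1 + a n)) ≤ 1 - c * Real.sqrt r ^ m :=
      sub_le_sub_left (mul_le_mul_of_nonneg_left hlow hc.le) 1
    refine ⟨⟨?_, ?_⟩, ?_⟩
    · have : 0 ≤ c * (a n ^ (m + 1) * (1 + a n)) * (1 - a n) := by positivity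
      linarith
    · linarith [mul_nonneg hnonneg hgap]
    · calc 1 - a (n + 1)
          ≤ (1 - c * Real.sqrt r ^ m) * (1 - a n) := by
            rw [hfactor]
            exact mul_le_mul_of_nonneg_right hle hgap
        _ ≤ (1 - c * Real.sqrt r ^ m) * ((1 - c * Real.sqrt r ^ m) ^ n * (1 - a 0)) :=
            mul_le_mul_of_nonneg_left hgeom (hnonneg.trans hle)
        _ = (1 - c * Real.sqrt r ^ m) ^ (n + 1) * (1 - a 0) := by ring
end
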